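/- arXiv:2312.02426 — 2 statements merged into one kernel-verified Lean document; each statement's English description precedes it below -/
import Mathlib

section
/- Let A be a finite nonempty set of positive integers and let p ≥ 1. Then w^A(n) = w^A(n + p) holds for all n ≥ 0 if and only if for every x ∈ A and every integer m with 0 ≤ m < x, w^A(m) = 0 implies w^A(m + p − x) = 1. -/
open Classical in
/-- The winning sequence on ℕ, where `seed` gives values at negative positions. -/
noncomputable def subW (A : Set ℕ) (seed : ℤ → ℕ) : ℕ → ℕ := fun n =>
  Nat.strongRecOn n (fun n ih =>
    if ∃ x ∈ A, (if h : 0 < x ∧ x ≤ n then ih (n - x) (by omega)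
                 else seed ((n : ℤ) - (x : ℤ))) = 0
    then 1 else 0)

/-- The winning sequence `w^{A,seed} : ℤ → ℕ`. -/
noncomputable def W (A : Set ℕ) (seed : ℤ → ℕ) : ℤ → ℕ := fun n =>
  if 0 ≤ n then subW A seed n.toNat else seed n

/-- The trivial seed (all ones), giving the unseeded sequence `w^A`. -/
def one : ℤ → ℕ := fun _ => 1

/-- The seed function determined by a string `S ∈ {0,1}^L`: `w(-i) = S_i` for `1 ≤ i ≤ L`,
and `w(n) = 1` for `n < -L`. -/
def seedExt (L : ℕ) (S : ℕ → Bool) : ℤ → ℕ := fun j =>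
  if -(L : ℤ) ≤ j ∧ j < 0 then (if S ((-j).toNat - 1) then 1 else 0) else 1

/-- `w` is eventually periodic over `p`. -/
def PeriodicOver (w : ℤ → ℕ) (p : ℕ) : Prop :=
  ∃ N : ℕ, ∀ n : ℤ, (N : ℤ) ≤ n → w n = w (n + p)

/-- The (eventual) period: the least `p ≥ 1` over which `w` is eventually periodic. -/
noncomputable def per (w : ℤ → ℕ) : ℕ := sInf {p : ℕ | 0 < p ∧ PeriodicOver w p}

/-- The preperiod: the least `N` that works for `p = per w`. -/
noncomputable def preper (w : ℤ → ℕ) : ℕ :=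
  sInf {N : ℕ | ∀ n : ℤ, (N : ℤ) ≤ n → w n = w (n + per w)}

/-- The recurrence of the winning sequence, with the seed read off at negative positions. -/
theorem subW_eq_one_iff (A : Set ℕ) (seed : ℤ → ℕ) (hpos : ∀ x ∈ A, 0 < x) (n : ℕ) :
    subW A seed n = 1 ↔ ∃ x ∈ A, W A seed ((n : ℤ) - x) = 0 := by
  have key : ∀ x ∈ A,
      ((if _ : 0 < x ∧ x ≤ n then subW A seed (n - x) else seed ((n : ℤ) - (x : ℤ))) =
        W A seed ((n : ℤ) - x)) := by
    intro x hx
    have := hpos x hx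
    unfold W
    by_cases h : x ≤ n
    · rw [dif_pos ⟨this, h⟩, if_pos (by omega)]
      congr 1
      omega
    · rw [dif_neg (by tauto), if_neg (by omega)]
  have unfolded : subW A seed n = 1 ↔ ∃ x ∈ A,
      (if _ : 0 < x ∧ x ≤ n then subW A seed (n - x) else seed ((n : ℤ) - (x : ℤ))) = 0 := by
    unfold subW
    rw [Nat.strongRecOn_eq]
    split_ifs with h
    · exact iff_of_true rfl h
    · exact iff_of_false not_false h
  rw [unfolded]
  exact exists_congr fun x => and_congr_right fun hx => by rw [key x hx]

theorem subW_eq_zero_or_one (A : Set ℕ) (seed : ℤ → ℕ) (n : ℕ) :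
    subW A seed n = 0 ∨ subW A seed n = 1 := by
  unfold subW
  rw [Nat.strongRecOn_eq]
  split_ifs <;> simp

theorem W_one_eq_zero_or_one (A : Set ℕ) (n : ℤ) : W A one n = 0 ∨ W A one n = 1 := by
  unfold W
  split_ifs
  · exact subW_eq_zero_or_one A one _
  · exact Or.inr rfl

theorem W_one_of_neg (A : Set ℕ) {n : ℤ} (hn : n < 0) : W A one n = 1 := by
  rw [W, if_neg (by omega), one]

theorem W_eq_one_iff (A : Set ℕ) (seed : ℤ → ℕ) (hpos : ∀ x ∈ A, 0 < x) {n : ℤ} (hn : 0 ≤ n) :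
    W A seed n = 1 ↔ ∃ x ∈ A, W A seed (n - x) = 0 := by
  lift n to ℕ using hn
  rw [← subW_eq_one_iff A seed hpos n]
  simp [W]


/-- translating zeros: `w^A` is purely periodic over `p` iff for all
`x ∈ A` and `0 ≤ m < x`, `w^A(m) = 0` implies `w^A(m + p - x) = 1`. -/
theorem stmt_7 (A : Finset ℕ) (hA : A.Nonempty) (hpos : ∀ x ∈ A, 0 < x)
    (p : ℕ) (hp : 1 ≤ p) :
    (∀ n : ℤ, 0 ≤ n → W ↑A one n = W ↑A one (n + p)) ↔
    (∀ x ∈ A, ∀ m : ℕ, m < x →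
      W ↑A one m = 0 → W ↑A one ((m : ℤ) + p - x) = 1) := by
  have rec_iff := fun {n : ℤ} (hn : 0 ≤ n) => W_eq_one_iff (↑A) one hpos hn
  have bool := W_one_eq_zero_or_one (↑A : Set ℕ)
  constructor
  · intro h x hx m _ hm
    refine (bool _).resolve_left fun h0 => ?_
    have h1 : W ↑A one ((m : ℤ) + p) = 1 := (rec_iff (by omega)).2 ⟨x, hx, h0⟩
    have := h m (by omega)
    omega
  · intro h n hn
    lift n to ℕ using hn
    induction n using Nat.strong_induction_on with
    | _ n ih =>
      have shift : ∀ x ∈ A, x ≤ n →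
          W ↑A one ((n : ℤ) - x) = W ↑A one ((n : ℤ) + p - x) := by
        intro x hx hxn
        have := ih (n - x) (by have := hpos x hx; omega)
        rw [Nat.cast_sub hxn] at this
        rw [this]
        congr 1
        ring
      rcases bool n with h0 | h1
      · rcases bool ((n : ℤ) + p) with h0' | h1'
        · rw [h0, h0']
        · obtain ⟨x, hx, hz⟩ := (rec_iff (by omega)).1 h1'
          by_cases hxn : x ≤ n
          · have : W ↑A one (n : ℤ) = 1 :=
              (rec_iff (by omega)).2 ⟨x, hx, (shift x hx hxn).trans hz⟩
            omega
          · have := h x hx n (by omega) h0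
            omega
      · obtain ⟨x, hx, hz⟩ := (rec_iff (by omega)).1 h1
        have hxn : x ≤ n := by
          by_contra hlt
          have := W_one_of_neg (↑A : Set ℕ) (n := (n : ℤ) - x) (by omega)
          omega
        rw [h1, (rec_iff (by omega)).2 ⟨x, hx, (shift x hx hxn).symm.trans hz⟩]
end

section
/- Let A = {a, b, a + b} with 0 < a < b. Set k = ⌊(b − 1)/(2a)⌋, r = b mod 2a, and ã = a/gcd(a,b). If 1 ≤ r < a, then per(A) = ã·(2b + r); otherwise (r = 0 or r ≥ a), per(A) = b + 2a(k + 1). In both cases preper(A) = 0. -/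
/-- `G` is the set of zeros of the unseeded winning sequence of the `{a, b, a + b}` game. -/
def IsZeroSet (a b : ℤ) (G : ℤ → Prop) : Prop :=
  ∀ n, G n ↔ 0 ≤ n ∧ ¬ G (n - a) ∧ ¬ G (n - b) ∧ ¬ G (n - (a + b))

/-- The integers lying in the first half of their residue block modulo `2 * a`. -/
def FirstHalf (a x : ℤ) : Prop := x % (2 * a) < a

lemma firstHalf_add_mul (a x k : ℤ) : FirstHalf a (x + 2 * a * k) ↔ FirstHalf a x := by
  simp [FirstHalf]

lemma firstHalf_of_lt {a x : ℤ} (h0 : 0 ≤ x) (h1 : x < a) : FirstHalf a x := by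
  unfold FirstHalf
  rw [Int.emod_eq_of_lt h0 (by omega)]
  exact h1

lemma firstHalf_add {a : ℤ} (ha : 0 < a) (x : ℤ) :
    FirstHalf a (x + a) ↔ ¬ FirstHalf a x := by
  have h := Int.mul_ediv_add_emod x (2 * a)
  have h0 := Int.emod_nonneg x (show 2 * a ≠ 0 by omega)
  have h1 := Int.emod_lt_of_pos x (show 0 < 2 * a by omega)
  by_cases hx : FirstHalf a x
  · simp only [hx, not_true, iff_false]
    unfold FirstHalf at hx ⊢
    have : (x + a) % (2 * a) = x % (2 * a) + a := by
      conv_lhs => rw [show x + a = (x % (2 * a) + a) + 2 * a * (x / (2 * a)) by linarith]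
      rw [Int.add_mul_emod_self_left, Int.emod_eq_of_lt (by omega) (by omega)]
    omega
  · simp only [hx, not_false_iff, iff_true]
    unfold FirstHalf at hx ⊢
    have : (x + a) % (2 * a) = x % (2 * a) - a := by
      conv_lhs => rw [show x + a = (x % (2 * a) - a) + 2 * a * (x / (2 * a) + 1) by linarith]
      rw [Int.add_mul_emod_self_left, Int.emod_eq_of_lt (by omega) (by omega)]
    omega

lemma not_firstHalf_of_le {a x : ℤ} (h0 : a ≤ x) (h1 : x < 2 * a) : ¬ FirstHalf a x := by
  have := (firstHalf_add (a := a) (by omega) (x - a))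
  rw [sub_add_cancel] at this
  rw [this, not_not]
  exact firstHalf_of_lt (by omega) (by omega)

/-- The shape of `G` on the `a + b` positions preceding `s`. -/
def BlockStart (a b : ℤ) (G : ℤ → Prop) (s t : ℤ) : Prop :=
  (∀ i, 1 ≤ i → i ≤ b → ¬ G (s - i)) ∧ ∀ i, 1 ≤ i → i ≤ a → (G (s - b - i) ↔ i ≤ t)

/-- Admissible data for a block: `l` positions following the half-block pattern with phase `t`,
then `b` positions outside the zero set, after which the phase is `t'`. -/
structure BlockStep (a b l t t' : ℤ) : Prop where
  t_nonneg : 0 ≤ t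
  t_lt : t < a
  t'_nonneg : 0 ≤ t'
  t'_lt : t' < a
  le_l : b ≤ l
  l_le : l ≤ a + b
  phase : ∀ x, FirstHalf a (l + t + x) ↔ FirstHalf a (t' + x)
  overlap : ∀ i, 0 ≤ i → i < l - b → FirstHalf a (b + i + t) → a ≤ i + t
  cover : ∀ i, 0 ≤ i → l - b + i < a → a ≤ l - b + i + t → a ≤ t' + i

lemma BlockStep.pattern {a b l t t' s : ℤ} {G : ℤ → Prop} (ha : 0 < a) (hab : a < b)
    (hG : IsZeroSet a b G) (hs : 0 ≤ s) (h : BlockStep a b l t t') (hst : BlockStart a b G s t) :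
    ∀ m : ℕ, (m : ℤ) < l → (G (s + m) ↔ FirstHalf a (m + t)) := by
  obtain ⟨h1, h2⟩ := hst
  have ht0 := h.t_nonneg
  have ht1 := h.t_lt
  have hl := h.l_le
  intro m
  induction m using Nat.strong_induction_on with
  | _ m ih =>
  intro hm
  rw [hG]
  have hflip : FirstHalf a (m + t) ↔ ¬ FirstHalf a (m - a + t) := by
    rw [← firstHalf_add ha]
    ring_nf
  rcases lt_or_ge (m : ℤ) a with hma | hma
  · have e1 : ¬ G (s + m - a) := by
      have := h1 (a - m) (by omega) (by omega)
      rwa [show s - (a - m) = s + m - a by ring] at this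
    have e2 : ¬ G (s + m - b) := by
      have := h1 (b - m) (by omega) (by omega)
      rwa [show s - (b - m) = s + m - b by ring] at this
    have e3 := h2 (a - m) (by omega) (by omega)
    rw [show s - b - (a - m) = s + m - (a + b) by ring] at e3
    have e4 : FirstHalf a (m + t) ↔ m + t < a := by
      refine ⟨fun hf => ?_, fun hf => firstHalf_of_lt (by omega) hf⟩
      by_contra hc
      exact not_firstHalf_of_le (by omega) (by omega) hf
    rw [e4, e3]
    simp only [e1, e2, not_false_iff, true_and]
    omega
  · have e1 : G (s + m - a) ↔ FirstHalf a (m - a + t) := by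
      have := ih (m - a.toNat) (by omega) (by omega)
      have hc : ((m - a.toNat : ℕ) : ℤ) = m - a := by omega
      rw [hc] at this
      rw [← this]
      ring_nf
    have e3 : ¬ G (s + m - (a + b)) := by
      have := h1 (a + b - m) (by omega) (by omega)
      rwa [show s - (a + b - m) = s + m - (a + b) by ring] at this
    rw [hflip, e1]
    rcases lt_or_ge (m : ℤ) b with hmb | hmb
    · have e2 : ¬ G (s + m - b) := by
        have := h1 (b - m) (by omega) (by omega)
        rwa [show s - (b - m) = s + m - b by ring] at this
      simp only [e2, e3, not_false_iff, and_true]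
      exact ⟨fun h => h.2, fun h => ⟨by omega, h⟩⟩
    · refine ⟨fun h => h.2.1, fun hf => ⟨by omega, hf, ?_, e3⟩⟩
      have hov := h.overlap (m - b) (by omega) (by omega)
        (by rw [show b + (m - b) + t = m + t by ring]; exact hflip.2 hf)
      have := ih (m - b.toNat) (by omega) (by omega)
      have hc : ((m - b.toNat : ℕ) : ℤ) = m - b := by omega
      rw [hc] at this
      rw [show s + (m : ℤ) - b = s + (m - b) by ring, this]
      exact not_firstHalf_of_le (by omega) (by omega)

lemma BlockStep.tail {a b l t t' s : ℤ} {G : ℤ → Prop} (ha : 0 < a) (hab : a < b)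
    (hG : IsZeroSet a b G) (hs : 0 ≤ s) (h : BlockStep a b l t t') (hst : BlockStart a b G s t)
    (i : ℤ) (hi0 : 0 ≤ i) (hib : i < b) : ¬ G (s + l + i) := by
  have hpat : ∀ m : ℤ, 0 ≤ m → m < l → (G (s + m) ↔ FirstHalf a (m + t)) := by
    intro m h0 h1
    lift m to ℕ using h0
    exact h.pattern ha hab hG hs hst m h1
  have ht0 := h.t_nonneg
  have ht1 := h.t_lt
  have ht0' := h.t'_nonneg
  have ht1' := h.t'_lt
  have hl := h.l_le
  have hl' := h.le_l
  intro hg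
  rw [hG] at hg
  obtain ⟨-, g1, g2, g3⟩ := hg
  rw [show s + l + i - b = s + (l - b + i) by ring, hpat _ (by omega) (by omega)] at g2
  rcases lt_or_ge (l - b + i) a with hd | hd
  · have hc : a ≤ l - b + i + t := by
      by_contra hc
      exact g2 (firstHalf_of_lt (by omega) (by omega))
    have hcov := h.cover i hi0 hd hc
    rw [show s + l + i - a = s + (l + i - a) by ring, hpat _ (by omega) (by omega),
      show l + i - a + t = l + t + (i - a) by ring, h.phase] at g1
    exact g1 (firstHalf_of_lt (by omega) (by omega))
  · rw [show s + l + i - (a + b) = s + (l - b + i - a) by ring, hpat _ (by omega) (by omega),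
      ← firstHalf_add ha, show l - b + i - a + t + a = l - b + i + t by ring] at g3
    exact g2 g3

lemma BlockStep.next {a b l t t' s : ℤ} {G : ℤ → Prop} (ha : 0 < a) (hab : a < b)
    (hG : IsZeroSet a b G) (hs : 0 ≤ s) (h : BlockStep a b l t t') (hst : BlockStart a b G s t) :
    BlockStart a b G (s + l + b) t' := by
  have ht0' := h.t'_nonneg
  have ht1' := h.t'_lt
  have hl' := h.le_l
  refine ⟨fun i h1 h2 => ?_, fun i h1 h2 => ?_⟩
  · have := h.tail ha hab hG hs hst (b - i) (by omega) (by omega)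
    rwa [show s + l + (b - i) = s + l + b - i by ring] at this
  · have := h.pattern ha hab hG hs hst (l - i).toNat (by omega)
    rw [Int.toNat_of_nonneg (by omega)] at this
    rw [show s + l + b - b - i = s + (l - i) by ring, this,
      show l - i + t = l + t + (-i) by ring, h.phase]
    refine ⟨fun hf => ?_, fun hf => firstHalf_of_lt (by omega) (by omega)⟩
    by_contra hc
    rw [← firstHalf_add_mul a _ 1] at hf
    exact not_firstHalf_of_le (by omega) (by omega) hf

/-- A zero of a block preceded by `a + b` nonzeros is the start of the block, with phase `0`. -/
lemma BlockStep.eq_zero_of_gap {a b l t t' s : ℤ} {G : ℤ → Prop} (ha : 0 < a) (hab : a < b)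
    (hG : IsZeroSet a b G) (hs : 0 ≤ s) (h : BlockStep a b l t t') (hst : BlockStart a b G s t)
    {m : ℤ} (hm0 : 0 ≤ m) (hm : m < l + b) (hg : G (s + m))
    (hgap : ∀ i, 1 ≤ i → i ≤ a + b → ¬ G (s + m - i)) : m = 0 ∧ t = 0 := by
  have hpat : ∀ m : ℤ, 0 ≤ m → m < l → (G (s + m) ↔ FirstHalf a (m + t)) := by
    intro m h0 h1
    lift m to ℕ using h0
    exact h.pattern ha hab hG hs hst m h1
  have ht0 := h.t_nonneg
  have ht1 := h.t_lt
  have hml : m < l := by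
    by_contra hc
    have := h.tail ha hab hG hs hst (m - l) (by omega) (by omega)
    rw [show s + l + (m - l) = s + m by ring] at this
    exact this hg
  have hm_zero : m = 0 := by
    by_contra hne
    have hf := (hpat m hm0 hml).1 hg
    have hprev : ¬ FirstHalf a (m - 1 + t) := by
      rw [← hpat (m - 1) (by omega) (by omega)]
      have := hgap 1 (by omega) (by omega)
      rwa [show s + m - 1 = s + (m - 1) by ring] at this
    rcases lt_or_ge a m with hlt | hle
    · have := hgap (a + 1) (by omega) (by omega)
      rw [show s + m - (a + 1) = s + (m - 1 - a) by ring, hpat _ (by omega) (by omega),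
        ← firstHalf_add ha, show m - 1 - a + t + a = m - 1 + t by ring] at this
      exact hprev this
    · have h1 : a ≤ m - 1 + t := by
        by_contra hc
        exact hprev (firstHalf_of_lt (by omega) (by omega))
      exact not_firstHalf_of_le (by omega) (by omega) hf
  subst hm_zero
  refine ⟨rfl, ?_⟩
  by_contra hne
  have h1 := (hst.2 1 (by omega) (by omega)).2 (by omega)
  have h2 := hgap (b + 1) (by omega) (by omega)
  rw [show s + 0 - (b + 1) = s - b - 1 by ring] at h2
  exact h2 h1

/-- A chain of blocks whose phase first returns to `0` at `J` makes `S J` the pure period. -/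
lemma isZeroSet_periodic {a b : ℤ} {G : ℤ → Prop} (ha : 0 < a) (hab : a < b)
    (hG : IsZeroSet a b G) (S t : ℕ → ℤ) (hS0 : S 0 = 0) (ht0 : t 0 = 0)
    (hstep : ∀ j, BlockStep a b (S (j + 1) - S j - b) (t j) (t (j + 1)))
    (J : ℕ) (hJ : t J = 0) (hJmin : ∀ j, 0 < j → j < J → t j ≠ 0) :
    (∀ n, 0 ≤ n → (G (n + S J) ↔ G n)) ∧
    ∀ q : ℤ, 0 < q → (∃ N : ℕ, ∀ n : ℤ, (N : ℤ) ≤ n → (G n ↔ G (n + q))) → S J ≤ q := by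
  have hneg : ∀ n, n < 0 → ¬ G n := fun n hn hg => by
    have := ((hG n).1 hg).1
    omega
  have hmono : ∀ j, S j < S (j + 1) := fun j => by
    have := (hstep j).le_l
    omega
  have hSnn : ∀ j, 0 ≤ S j := fun j => by
    induction j with
    | zero => omega
    | succ j ih => have := hmono j; omega
  have hstart : ∀ j, BlockStart a b G (S j) (t j) := by
    intro j
    induction j with
    | zero =>
      rw [hS0, ht0]
      refine ⟨fun i h1 h2 => hneg _ (by omega), fun i h1 h2 => ?_⟩
      simp only [hneg (0 - b - i) (by omega), false_iff]
      omega
    | succ j ih =>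
      have := (hstep j).next ha hab hG (hSnn j) ih
      rwa [show S j + (S (j + 1) - S j - b) + b = S (j + 1) by ring] at this
  have hgapJ : ∀ i, 1 ≤ i → i ≤ a + b → ¬ G (S J - i) := by
    intro i h1 h2
    rcases le_or_gt i b with hb | hb
    · exact (hstart J).1 i h1 hb
    · have := (hstart J).2 (i - b) (by omega) (by omega)
      rw [show S J - b - (i - b) = S J - i by ring, hJ] at this
      rw [this]
      omega
  have hper' : ∀ m : ℕ, G ((m : ℤ) - (a + b) + S J) ↔ G ((m : ℤ) - (a + b)) := by
    intro m
    induction m using Nat.strong_induction_on with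
    | _ m ih =>
    rcases lt_or_ge (m : ℤ) (a + b) with hm | hm
    · have h1 := hgapJ (a + b - m) (by omega) (by omega)
      rw [show S J - (a + b - m) = m - (a + b) + S J by ring] at h1
      simp only [h1, hneg ((m : ℤ) - (a + b)) (by omega)]
    · have key : ∀ x : ℤ, 0 < x → x ≤ a + b →
          (G ((m : ℤ) - (a + b) + S J - x) ↔ G ((m : ℤ) - (a + b) - x)) := by
        intro x h0 h1
        have := ih (m - x.toNat) (by omega)
        rw [show ((m - x.toNat : ℕ) : ℤ) = m - x by omega] at this
        rw [show (m : ℤ) - (a + b) + S J - x = m - x - (a + b) + S J by ring, this]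
        ring_nf
      have := hSnn J
      rw [hG ((m : ℤ) - (a + b) + S J), hG ((m : ℤ) - (a + b)), key a ha (by omega),
        key b (by omega) (by omega), key (a + b) (by omega) le_rfl]
      simp only [show 0 ≤ (m : ℤ) - (a + b) + S J by omega, show 0 ≤ (m : ℤ) - (a + b) by omega]
  have hper : ∀ n, -(a + b) ≤ n → (G (n + S J) ↔ G n) := by
    intro n hn
    have := hper' (n + (a + b)).toNat
    rw [Int.toNat_of_nonneg (by omega)] at this
    simpa using this
  refine ⟨fun n hn => hper n (by omega), ?_⟩
  rintro q hq ⟨N, hN⟩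
  by_contra hlt
  push Not at hlt
  have hperM : ∀ (M : ℕ) n, -(a + b) ≤ n → (G (n + M * S J) ↔ G n) := by
    intro M
    induction M with
    | zero => simp
    | succ M ih =>
      intro n hn
      have h0 : 0 ≤ (M : ℤ) * S J := mul_nonneg (by omega) (hSnn J)
      rw [show n + ((M + 1 : ℕ) : ℤ) * S J = n + M * S J + S J by push_cast; ring,
        hper _ (by omega), ih n hn]
  have hpq : ∀ n, -(a + b) ≤ n → (G n ↔ G (n + q)) := by
    intro n hn
    let M : ℕ := N + (a + b).toNat
    have hM : (M : ℤ) = N + (a + b) := by simp only [M]; omega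
    have hbig : (M : ℤ) ≤ M * S J := le_mul_of_one_le_right (by omega) (by omega)
    rw [← hperM M n hn, hN _ (by omega), ← hperM M (n + q) (by omega)]
    ring_nf
  have hG0 : G 0 := by
    rw [hG]
    exact ⟨le_rfl, hneg _ (by omega), hneg _ (by omega), hneg _ (by omega)⟩
  have hgq : G q := by
    have := (hpq 0 (by omega)).1 hG0
    rwa [zero_add] at this
  have hgap : ∀ i, 1 ≤ i → i ≤ a + b → ¬ G (q - i) := by
    intro i h1 h2
    have := hpq (-i) (by omega)
    rw [show q - i = -i + q by ring, ← this]
    exact hneg _ (by omega)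
  have hfind : ∀ J, q < S J → ∃ j < J, S j ≤ q ∧ q < S (j + 1) := by
    intro J
    induction J with
    | zero => intro h; omega
    | succ J ih =>
      intro h
      rcases lt_or_ge q (S J) with h' | h'
      · obtain ⟨j, hj, hj'⟩ := ih h'
        exact ⟨j, by omega, hj'⟩
      · exact ⟨J, by omega, h', h⟩
  obtain ⟨j, hjJ, hj1, hj2⟩ := hfind J hlt
  obtain ⟨hm, ht⟩ := (hstep j).eq_zero_of_gap ha hab hG (hSnn j) (hstart j) (m := q - S j)
    (by omega) (by omega) (by rwa [add_sub_cancel])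
    (by rw [add_sub_cancel]; exact hgap)
  have hj0 : 0 < j := by
    rcases Nat.eq_zero_or_pos j with h0 | h0
    · subst h0; omega
    · exact h0
  exact hJmin j hj0 hjJ ht

lemma BlockStep.of_add_lt {a b r k t : ℤ} (hb : b = 2 * a * k + r) (hr : 0 ≤ r)
    (ha : 0 < a) (ht : 0 ≤ t) (h : t + r < a) : BlockStep a b b t (t + r) where
  t_nonneg := ht
  t_lt := by omega
  t'_nonneg := by omega
  t'_lt := h
  le_l := le_rfl
  l_le := by omega
  phase x := by
    rw [← firstHalf_add_mul a (t + r + x) k, hb]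
    ring_nf
  overlap i h0 h1 := by omega
  cover i h0 h1 h2 := by omega

lemma BlockStep.of_le_add {a b r k t : ℤ} (hb : b = 2 * a * k + r) (hr : r < a)
    (ha : 0 < a) (ht : 0 ≤ t) (hta : t < a) (h : a ≤ t + r) :
    BlockStep a b (a + b) t (t + r - a) where
  t_nonneg := ht
  t_lt := hta
  t'_nonneg := by omega
  t'_lt := by omega
  le_l := by omega
  l_le := le_rfl
  phase x := by
    rw [← firstHalf_add_mul a (t + r - a + x) (k + 1), hb]
    ring_nf
  overlap i h0 h1 hf := by
    by_contra hc
    rw [show b + i + t = r + i + t + 2 * a * k by rw [hb]; ring, firstHalf_add_mul] at hf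
    exact not_firstHalf_of_le (by omega) (by omega) hf
  cover i h0 h1 h2 := by omega

lemma BlockStep.of_phase_zero {a b K : ℤ} (ha : 0 < a) (h1 : b ≤ 2 * a * K)
    (h2 : 2 * a * K ≤ a + b) : BlockStep a b (2 * a * K) 0 0 where
  t_nonneg := le_rfl
  t_lt := ha
  t'_nonneg := le_rfl
  t'_lt := ha
  le_l := h1
  l_le := h2
  phase x := by
    rw [← firstHalf_add_mul a (0 + x) K]
    ring_nf
  overlap i h0 h3 hf := by
    exfalso
    rw [show b + i + 0 = (b + i - 2 * a * K + 2 * a) + 2 * a * (K - 1) by ring,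
      firstHalf_add_mul] at hf
    exact not_firstHalf_of_le (by omega) (by omega) hf
  cover i h0 h3 h4 := by omega

lemma W_of_neg (A : Set ℕ) (seed : ℤ → ℕ) {n : ℤ} (hn : n < 0) : W A seed n = seed n := by
  simp [W, not_le.2 hn]

open Classical in
lemma W_of_nonneg (A : Set ℕ) (hA : ∀ x ∈ A, 0 < x) (seed : ℤ → ℕ) {n : ℤ} (hn : 0 ≤ n) :
    W A seed n = if ∃ x ∈ A, W A seed (n - x) = 0 then 1 else 0 := by
  lift n to ℕ using hn
  have hx : ∀ x ∈ A, (if _ : 0 < x ∧ x ≤ n then subW A seed (n - x)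
      else seed ((n : ℤ) - (x : ℤ))) = W A seed ((n : ℤ) - x) := by
    intro x hxA
    have hx0 := hA x hxA
    unfold W
    rcases le_or_gt x n with h | h
    · rw [dif_pos ⟨hx0, h⟩, if_pos (by omega)]
      congr 1
      omega
    · rw [dif_neg (by omega), if_neg (by omega)]
  have hunf : subW A seed n = if ∃ x ∈ A, (if _ : 0 < x ∧ x ≤ n then subW A seed (n - x)
      else seed ((n : ℤ) - (x : ℤ))) = 0 then 1 else 0 := by
    conv_lhs => unfold subW
    rw [Nat.strongRecOn_eq]
    rfl
  have hiff : (∃ x ∈ A, (if _ : 0 < x ∧ x ≤ n then subW A seed (n - x)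
      else seed ((n : ℤ) - (x : ℤ))) = 0) ↔ ∃ x ∈ A, W A seed ((n : ℤ) - x) = 0 :=
    exists_congr fun x => and_congr_right fun hxA => by rw [hx x hxA]
  have hW : W A seed n = subW A seed n := by simp [W]
  rw [hW, hunf]
  by_cases h : ∃ x ∈ A, W A seed ((n : ℤ) - x) = 0
  · rw [if_pos (hiff.2 h), if_pos h]
  · rw [if_neg (fun h' => h (hiff.1 h')), if_neg h]

lemma W_one_le_one (A : Set ℕ) (hA : ∀ x ∈ A, 0 < x) (n : ℤ) : W A one n ≤ 1 := by
  rcases lt_or_ge n 0 with h | h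
  · rw [W_of_neg A one h]
    rfl
  · rw [W_of_nonneg A hA one h]
    split_ifs <;> omega

lemma isZeroSet_W {a b : ℕ} (ha : 0 < a) (hab : a < b) :
    IsZeroSet a b (fun n => W {a, b, a + b} one n = 0) := by
  classical
  intro n
  have hA : ∀ x ∈ ({a, b, a + b} : Set ℕ), 0 < x := by
    simp only [Set.mem_insert_iff, Set.mem_singleton_iff]
    omega
  rcases lt_or_ge n 0 with h | h
  · simp [W_of_neg _ one h, one, h]
  · simp only [W_of_nonneg _ hA one h]
    by_cases hex : ∃ x ∈ ({a, b, a + b} : Set ℕ), W {a, b, a + b} one (n - x) = 0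
    · rw [if_pos hex]
      simp only [Set.mem_insert_iff, Set.mem_singleton_iff, exists_eq_or_imp,
        exists_eq_left, Nat.cast_add] at hex
      tauto
    · rw [if_neg hex]
      simp only [Set.mem_insert_iff, Set.mem_singleton_iff, exists_eq_or_imp,
        exists_eq_left, Nat.cast_add] at hex
      tauto

lemma per_preper_eq_of_blocks {a b p : ℕ} (ha : 0 < a) (hab : a < b) (hp : 0 < p) (S t : ℕ → ℤ)
    (hS0 : S 0 = 0) (ht0 : t 0 = 0)
    (hstep : ∀ j, BlockStep a b (S (j + 1) - S j - b) (t j) (t (j + 1)))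
    (J : ℕ) (hJ : t J = 0) (hJmin : ∀ j, 0 < j → j < J → t j ≠ 0) (hSJ : S J = p) :
    per (W {a, b, a + b} one) = p ∧ preper (W {a, b, a + b} one) = 0 := by
  have hA : ∀ x ∈ ({a, b, a + b} : Set ℕ), 0 < x := by
    simp only [Set.mem_insert_iff, Set.mem_singleton_iff]
    omega
  have heq : ∀ m n, W {a, b, a + b} one m = W {a, b, a + b} one n ↔
      (W {a, b, a + b} one m = 0 ↔ W {a, b, a + b} one n = 0) := by
    intro m n
    have h1 := W_one_le_one _ hA m
    have h2 := W_one_le_one _ hA n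
    omega
  obtain ⟨h1, h2⟩ := isZeroSet_periodic (by exact_mod_cast ha) (by exact_mod_cast hab)
    (isZeroSet_W ha hab) S t hS0 ht0 hstep J hJ hJmin
  rw [hSJ] at h1 h2
  have hpure : ∀ n : ℤ, 0 ≤ n → W {a, b, a + b} one n = W {a, b, a + b} one (n + p) :=
    fun n hn => (heq _ _).2 (h1 n hn).symm
  have hper : per (W {a, b, a + b} one) = p := by
    refine le_antisymm (Nat.sInf_le ⟨hp, 0, fun n hn => hpure n (by simpa using hn)⟩) ?_
    refine le_csInf ⟨p, hp, 0, fun n hn => hpure n (by simpa using hn)⟩ ?_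
    rintro q ⟨hq, N, hN⟩
    exact_mod_cast h2 q (by exact_mod_cast hq) ⟨N, fun n hn => (heq _ _).1 (hN n hn)⟩
  refine ⟨hper, ?_⟩
  refine Nat.le_zero.1 (Nat.sInf_le ?_)
  intro n hn
  rw [hper]
  exact hpure n (by simpa using hn)

lemma per_preper_of_mod_lt {a b : ℕ} (ha : 0 < a) (hab : a < b) (hr : b % (2 * a) < a) :
    per (W {a, b, a + b} one) = (a / Nat.gcd a b) * (2 * b + b % (2 * a)) ∧
      preper (W {a, b, a + b} one) = 0 := by
  have hb := (Nat.div_add_mod b (2 * a)).symm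
  set r := b % (2 * a)
  set k := b / (2 * a)
  have hbZ : (b : ℤ) = 2 * a * k + r := by exact_mod_cast hb
  have hg : 0 < Nat.gcd a b := Nat.gcd_pos_of_pos_left _ ha
  have hJpos : 0 < a / Nat.gcd a b := Nat.div_pos (Nat.gcd_le_left _ ha) hg
  have hdvd : ∀ j, a ∣ r * j ↔ a / Nat.gcd a b ∣ j := by
    intro j
    have h1 : a ∣ r * j ↔ a ∣ b * j := by
      have e : b * j = a * (2 * k * j) + r * j := by
        conv_lhs => rw [hb]
        ring
      rw [e]
      exact (Nat.dvd_add_right (Dvd.intro _ rfl)).symm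
    rw [h1]
    have hcop := Nat.coprime_div_gcd_div_gcd hg
    rw [← hcop.dvd_mul_left, ← Nat.mul_dvd_mul_iff_left (b := a / _) hg, ← mul_assoc,
      Nat.mul_div_cancel' (Nat.gcd_dvd_left a b), Nat.mul_div_cancel' (Nat.gcd_dvd_right a b)]
  have hzero : ∀ j : ℕ, ((r : ℤ) * j) % a = 0 ↔ a / Nat.gcd a b ∣ j := by
    intro j
    rw [← hdvd, ← Int.dvd_iff_emod_eq_zero]
    exact_mod_cast Iff.rfl
  refine per_preper_eq_of_blocks ha hab (Nat.mul_pos hJpos (by omega))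
    (fun j => j * (2 * b + r) - (r * j : ℤ) % a) (fun j => (r * j : ℤ) % a) (by simp) (by simp)
    ?_ (a / Nat.gcd a b) ((hzero _).2 dvd_rfl) ?_ ?_
  · intro j
    have h0 := Int.emod_nonneg ((r : ℤ) * j) (show (a : ℤ) ≠ 0 by omega)
    have h1 := Int.emod_lt_of_pos ((r : ℤ) * j) (show (0 : ℤ) < a by omega)
    have hmod : ((r : ℤ) * (j + 1 : ℕ)) % a = ((r : ℤ) * j % a + r) % a := by
      push_cast
      rw [mul_add, mul_one, Int.emod_add_emod]
    simp only [hmod]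
    rcases lt_or_ge ((r : ℤ) * j % a + r) a with h | h
    · rw [Int.emod_eq_of_lt (by omega) h]
      convert BlockStep.of_add_lt hbZ (by omega) (by omega) h0 h using 1
      push_cast
      ring
    · have : ((r : ℤ) * j % a + r) % a = (r : ℤ) * j % a + r - a := by
        rw [← Int.sub_emod_right, Int.emod_eq_of_lt (by omega) (by omega)]
      rw [this]
      convert BlockStep.of_le_add hbZ (by omega) (by omega) h0 h1 h using 1
      push_cast
      ring
  · intro j hj0 hj hz
    exact absurd (Nat.le_of_dvd hj0 ((hzero j).1 hz)) (by omega)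
  · simp only [(hzero _).2 dvd_rfl]
    push_cast
    ring

lemma per_preper_of_mod_eq_zero_or_le {a b : ℕ} (ha : 0 < a) (hab : a < b)
    (hr : b % (2 * a) = 0 ∨ a ≤ b % (2 * a)) :
    per (W {a, b, a + b} one) = b + 2 * a * ((b - 1) / (2 * a) + 1) ∧
      preper (W {a, b, a + b} one) = 0 := by
  set K := (b - 1) / (2 * a) + 1 with hK
  have hdm := Nat.div_add_mod b (2 * a)
  have hdm' := Nat.div_add_mod (b - 1) (2 * a)
  have hlt := Nat.mod_lt (b - 1) (show 2 * a > 0 by omega)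
  have hlt' := Nat.mod_lt b (show 2 * a > 0 by omega)
  have hKm : 2 * a * K = 2 * a * ((b - 1) / (2 * a)) + 2 * a := by rw [hK]; ring
  have h1 : b ≤ 2 * a * K := by omega
  have h2 : 2 * a * K ≤ a + b := by
    rcases hr with h0 | h0
    · by_contra hc
      have hq' : b / (2 * a) < K := by
        by_contra hc'
        have := Nat.mul_le_mul_left (2 * a) (show K ≤ b / (2 * a) by omega)
        omega
      have := Nat.mul_le_mul_left (2 * a) (show b / (2 * a) ≤ (b - 1) / (2 * a) by omega)
      omega
    · have := Nat.mul_le_mul_left (2 * a)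
        (Nat.div_le_div_right (c := 2 * a) (show b - 1 ≤ b by omega))
      omega
  refine per_preper_eq_of_blocks ha hab (by omega) (fun j => j * (b + 2 * a * K)) (fun _ => 0)
    (by simp) rfl ?_ 1 rfl (by omega) (by push_cast; ring)
  intro j
  convert BlockStep.of_phase_zero (a := a) (b := b) (K := K) (by omega) (by exact_mod_cast h1)
    (by exact_mod_cast h2) using 1
  push_cast
  ring

/-- for `A = {a, b, a+b}` with `a < b`, `k = ⌊(b-1)/(2a)⌋`,
`r = b mod 2a`, `ã = a/gcd(a,b)`: if `1 ≤ r < a` then `per(A) = ã(2b + r)`,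
otherwise `per(A) = b + 2a(k+1)`; and `preper(A) = 0`. -/
theorem stmt_17 (a b : ℕ) (ha : 0 < a) (hab : a < b) :
    preper (W {a, b, a + b} one) = 0 ∧
    ((1 ≤ b % (2 * a) ∧ b % (2 * a) < a) →
      per (W {a, b, a + b} one) = (a / Nat.gcd a b) * (2 * b + b % (2 * a))) ∧
    ((b % (2 * a) = 0 ∨ a ≤ b % (2 * a)) →
      per (W {a, b, a + b} one) = b + 2 * a * ((b - 1) / (2 * a) + 1)) := by
  refine ⟨?_, fun h => (per_preper_of_mod_lt ha hab h.2).1,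
    fun h => (per_preper_of_mod_eq_zero_or_le ha hab h).1⟩
  rcases lt_or_ge (b % (2 * a)) a with h | h
  · exact (per_preper_of_mod_lt ha hab h).2
  · exact (per_preper_of_mod_eq_zero_or_le ha hab (Or.inr h)).2
end
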